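/- Let u ∈ L∞(Y) with ‖u‖_∞ ≤ M, and suppose f₀(y,ξ) = 𝟙_{ξ<u(y)} satisfies Σᵢ ∂_{yᵢ}(aᵢ(y,ξ) f₀) = ∂_ξ m in 𝒟'(Y×ℝ) for a nonnegative measure m supported in Y × [-M,M], where div_y A(y,ξ) = 0 for all ξ (divergence-free flux, aᵢ = ∂_ξ Aᵢ). Then m = 0, i.e. Σᵢ ∂_{yᵢ}(aᵢ(y,ξ)𝟙_{ξ<u(y)}) = 0. -/

import Mathlib

open MeasureTheory

/-- The integer lattice vector with coordinates `k`. -/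
noncomputable def latticeVec {N : ℕ} (k : Fin N → ℤ) : EuclideanSpace ℝ (Fin N) :=
  ∑ i, k i • EuclideanSpace.single i (1 : ℝ)

lemma latticeVec_apply {N : ℕ} (k : Fin N → ℤ) (j : Fin N) : latticeVec k j = k j := by
  simp [latticeVec, Pi.single_apply]

lemma latticeVec_mem {N : ℕ} (G : AddSubgroup (EuclideanSpace ℝ (Fin N)))
    (hG : ∀ i, EuclideanSpace.single i (1 : ℝ) ∈ G) (k : Fin N → ℤ) : latticeVec k ∈ G :=
  sum_mem fun i _ => zsmul_mem (hG i) _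

/-- A function invariant under the unit translations is invariant under the integer lattice. -/
lemma apply_add_latticeVec {N : ℕ} {β : Type*} {f : EuclideanSpace ℝ (Fin N) → β}
    (hf : ∀ x i, f (x + EuclideanSpace.single i 1) = f x) (k : Fin N → ℤ)
    (x : EuclideanSpace ℝ (Fin N)) : f (x + latticeVec k) = f x := by
  let G : AddSubgroup (EuclideanSpace ℝ (Fin N)) :=
    { carrier := {v | ∀ x, f (x + v) = f x}
      zero_mem' := fun x => by simp
      add_mem' := fun {a b} ha hb x => by rw [← add_assoc, hb, ha]
      neg_mem' := fun {a} ha x => by simpa using (ha (x + -a)).symm }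
  exact latticeVec_mem G (fun i x => hf x i) k x

/-- A measure invariant under the unit translations of the first variable is invariant under the
integer lattice. -/
lemma map_add_latticeVec {N : ℕ} {m : Measure (EuclideanSpace ℝ (Fin N) × ℝ)}
    (hm : ∀ i : Fin N, m.map (fun p => (p.1 + EuclideanSpace.single i 1, p.2)) = m)
    (k : Fin N → ℤ) : m.map (fun p => (p.1 + latticeVec k, p.2)) = m := by
  have hmeas (v : EuclideanSpace ℝ (Fin N)) :
      Measurable (fun p : EuclideanSpace ℝ (Fin N) × ℝ => (p.1 + v, p.2)) := by fun_prop
  have hcomp (v w : EuclideanSpace ℝ (Fin N)) :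
      (m.map (fun p => (p.1 + v, p.2))).map (fun p => (p.1 + w, p.2)) =
        m.map (fun p => (p.1 + (v + w), p.2)) := by
    rw [Measure.map_map (hmeas w) (hmeas v)]
    congr 1
    ext p : 1
    simp [add_assoc]
  have hzero : m.map (fun p => (p.1 + 0, p.2)) = m := by simp
  let G : AddSubgroup (EuclideanSpace ℝ (Fin N)) :=
    { carrier := {v | m.map (fun p => (p.1 + v, p.2)) = m}
      zero_mem' := hzero
      add_mem' := fun {a b} ha hb => by
        simp only [Set.mem_ofPred_eq] at ha hb ⊢
        rw [← hcomp, ha, hb]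
      neg_mem' := fun {a} ha => by
        simp only [Set.mem_ofPred_eq] at ha ⊢
        have h := hcomp a (-a)
        rwa [ha, add_neg_cancel, hzero] at h }
  exact latticeVec_mem G hm k

/-- The half-open unit cube. -/
def unitCube (N : ℕ) : Set (EuclideanSpace ℝ (Fin N)) := {x | ∀ i, x i ∈ Set.Ico (0 : ℝ) 1}

lemma measurableSet_unitCube (N : ℕ) : MeasurableSet (unitCube N) := by
  have : unitCube N = ⋂ i, (fun x : EuclideanSpace ℝ (Fin N) => x i) ⁻¹' Set.Ico (0 : ℝ) 1 := by
    ext x; simp [unitCube]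
  rw [this]
  exact MeasurableSet.iInter fun i => measurableSet_Ico.preimage (by fun_prop)

lemma sub_latticeVec_floor_mem_unitCube {N : ℕ} (x : EuclideanSpace ℝ (Fin N)) :
    x - latticeVec (fun i => ⌊x i⌋) ∈ unitCube N := fun i => by
  rw [PiLp.sub_apply, latticeVec_apply]
  exact ⟨by linarith [Int.floor_le (x i)], by linarith [Int.lt_floor_add_one (x i)]⟩

lemma eq_floor_of_sub_latticeVec_mem_unitCube {N : ℕ} {x : EuclideanSpace ℝ (Fin N)}
    {k : Fin N → ℤ} (h : x - latticeVec k ∈ unitCube N) : k = fun i => ⌊x i⌋ := by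
  ext i
  have hi := h i
  rw [PiLp.sub_apply, latticeVec_apply] at hi
  exact (Int.floor_eq_iff.2 ⟨by linarith [hi.1], by linarith [hi.2]⟩).symm

lemma norm_le_of_forall_mem_Icc {N : ℕ} {R : ℝ} (hR : 0 ≤ R) {x : EuclideanSpace ℝ (Fin N)}
    (hx : ∀ i, x i ∈ Set.Icc 0 R) : ‖x‖ ≤ (N + 1) * R := by
  refine abs_le_of_sq_le_sq' ?_ (by positivity) |>.2
  rw [EuclideanSpace.norm_sq_eq]
  calc ∑ i, ‖x i‖ ^ 2 ≤ ∑ _i : Fin N, R ^ 2 := by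
        gcongr with i
        rw [Real.norm_of_nonneg (hx i).1]
        exact (hx i).2
    _ = N * R ^ 2 := by simp
    _ ≤ ((N + 1) * R) ^ 2 := by
        rw [mul_pow]
        gcongr
        nlinarith [(Nat.cast_nonneg N : (0 : ℝ) ≤ N)]

/-- A lattice-periodic measure gives the block of `n ^ N` unit cells at least `n ^ N` times the
mass of one cell. -/
lemma pow_mul_measure_unitCube_le {N : ℕ} {m : Measure (EuclideanSpace ℝ (Fin N) × ℝ)}
    (hm : ∀ i : Fin N, m.map (fun p => (p.1 + EuclideanSpace.single i 1, p.2)) = m)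
    {I : Set ℝ} (hI : MeasurableSet I) (n : ℕ) :
    (n : ENNReal) ^ N * m (unitCube N ×ˢ I) ≤
      m ({x | ∀ i, x i ∈ Set.Icc (0 : ℝ) n} ×ˢ I) := by
  let T (k : Fin N → ℤ) : Set (EuclideanSpace ℝ (Fin N) × ℝ) :=
    {x | x - latticeVec k ∈ unitCube N} ×ˢ I
  have hTm (k) : MeasurableSet (T k) :=
    ((measurableSet_unitCube N).preimage (by fun_prop)).prod hI
  have hT (k) : m (T k) = m (unitCube N ×ˢ I) := by
    conv_lhs => rw [← map_add_latticeVec hm k]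
    rw [Measure.map_apply (by fun_prop) (hTm k)]
    congr 1
    ext p
    simp [T]
  let S : Finset (Fin N → ℤ) := Fintype.piFinset fun _ => Finset.Ico (0 : ℤ) n
  calc (n : ENNReal) ^ N * m (unitCube N ×ˢ I) = ∑ k ∈ S, m (T k) := by
        simp [hT, S]
    _ = m (⋃ k ∈ S, T k) := by
        refine (measure_biUnion_finset (fun k _ l _ hkl => ?_) fun k _ => hTm k).symm
        refine Set.disjoint_left.2 fun p hk hl => hkl ?_
        rw [eq_floor_of_sub_latticeVec_mem_unitCube hk.1,
          eq_floor_of_sub_latticeVec_mem_unitCube hl.1]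
    _ ≤ _ := by
        refine measure_mono (Set.iUnion₂_subset fun k hk p hp => ⟨fun i => ?_, hp.2⟩)
        have h1 := hp.1 i
        rw [PiLp.sub_apply, latticeVec_apply] at h1
        have h2 := Finset.mem_Ico.1 (Fintype.mem_piFinset.1 hk i)
        have h3 : (0 : ℝ) ≤ k i := by exact_mod_cast h2.1
        have h4 : (k i : ℝ) + 1 ≤ n := by exact_mod_cast h2.2
        exact ⟨by linarith [h1.1], by linarith [h1.2]⟩

lemma measure_eq_zero_of_measure_unitCube {N : ℕ} {m : Measure (EuclideanSpace ℝ (Fin N) × ℝ)}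
    (hm : ∀ i : Fin N, m.map (fun p => (p.1 + EuclideanSpace.single i 1, p.2)) = m)
    {I : Set ℝ} (hI : MeasurableSet I) (h0 : m (unitCube N ×ˢ I) = 0)
    (hc : m {p | p.2 ∉ I} = 0) : m = 0 := by
  have hT (k : Fin N → ℤ) : m ({x | x - latticeVec k ∈ unitCube N} ×ˢ I) = 0 := by
    have hmeas : MeasurableSet ({x | x - latticeVec k ∈ unitCube N} ×ˢ I) :=
      ((measurableSet_unitCube N).preimage (f := fun x => x - latticeVec k) (by fun_prop)).prod hI
    rw [← map_add_latticeVec hm k, Measure.map_apply (by fun_prop) hmeas, ← h0]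
    congr 1
    ext p
    simp
  refine Measure.measure_univ_eq_zero.1 (measure_mono_null (fun p _ => ?_)
    (measure_union_null (measure_iUnion_null hT) hc))
  by_cases hp : p.2 ∈ I
  · exact Or.inl (Set.mem_iUnion.2 ⟨_, sub_latticeVec_floor_mem_unitCube p.1, hp⟩)
  · exact Or.inr hp

/-- The velocity of a periodic `C¹` flux is bounded on bounded ranges of the kinetic variable. -/
lemma exists_norm_deriv_le {N : ℕ} {A : EuclideanSpace ℝ (Fin N) → ℝ → EuclideanSpace ℝ (Fin N)}
    (hA : ContDiff ℝ 1 (fun p : EuclideanSpace ℝ (Fin N) × ℝ => A p.1 p.2))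
    (hAper : ∀ x ξ i, A (x + EuclideanSpace.single i 1) ξ = A x ξ) (L : ℝ) :
    ∃ C, ∀ x ξ, |ξ| ≤ L → ‖deriv (fun s => A x s) ξ‖ ≤ C := by
  have hderiv (p : EuclideanSpace ℝ (Fin N) × ℝ) : deriv (fun s => A p.1 s) p.2 =
      fderiv ℝ (fun p : EuclideanSpace ℝ (Fin N) × ℝ => A p.1 p.2) p (0, 1) := by
    have h1 := ((hA.differentiable one_ne_zero) (p.1, p.2)).hasFDerivAt
    exact (h1.comp_hasDerivAt p.2 ((hasDerivAt_const p.2 p.1).prodMk (hasDerivAt_id p.2))).deriv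
  have hcont : Continuous fun p : EuclideanSpace ℝ (Fin N) × ℝ =>
      deriv (fun s => A p.1 s) p.2 := by
    simp_rw [hderiv]
    exact (hA.continuous_fderiv one_ne_zero).clm_apply continuous_const
  obtain ⟨C, hC⟩ := ((isCompact_closedBall (0 : EuclideanSpace ℝ (Fin N)) (N + 1)).prod
    (isCompact_Icc (a := -L) (b := L))).exists_bound_of_continuousOn hcont.continuousOn
  refine ⟨C, fun x ξ hξ => ?_⟩
  have hper := apply_add_latticeVec (f := A) (fun x i => funext fun ξ => hAper x ξ i)
    (fun i => ⌊x i⌋) (x - latticeVec fun i => ⌊x i⌋)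
  rw [sub_add_cancel] at hper
  rw [hper]
  refine hC (_, ξ) ⟨?_, abs_le.1 hξ⟩
  have := norm_le_of_forall_mem_Icc zero_le_one fun i =>
    Set.Ico_subset_Icc_self (sub_latticeVec_floor_mem_unitCube x i)
  simpa using this

/-- A compactly supported smooth function on the line with unit slope on `[-M, M]`. -/
lemma exists_contDiff_deriv_eq_one {M : ℝ} (hM : 0 ≤ M) :
    ∃ χ : ℝ → ℝ, ContDiff ℝ (⊤ : ℕ∞) χ ∧ (∀ s, M + 2 < |s| → χ s = 0) ∧
      ∀ s, |s| ≤ M → deriv χ s = 1 := by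
  let b : ContDiffBump (0 : ℝ) := ⟨M + 1, M + 2, by linarith, by linarith⟩
  refine ⟨fun s => s * b s, contDiff_id.mul b.contDiff, fun s hs => ?_, fun s hs => ?_⟩
  · simp [b.zero_of_le_dist (x := s) (by simpa [b] using hs.le)]
  · have hmem : s ∈ Metric.ball (0 : ℝ) b.rIn := by
      simp only [b, mem_ball_zero_iff, Real.norm_eq_abs]
      linarith
    have : (fun s => s * b s) =ᶠ[nhds s] id := by
      filter_upwards [Metric.isOpen_ball.mem_nhds hmem] with t ht
      simp [b.one_of_mem_closedBall (Metric.ball_subset_closedBall ht)]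
    rw [this.deriv_eq, deriv_id]

lemma fderiv_dilate_mul_apply {E : Type*} [NormedAddCommGroup E] [NormedSpace ℝ E]
    {ψ : E → ℝ} {χ : ℝ → ℝ} (hψ : Differentiable ℝ ψ) (hχ : Differentiable ℝ χ) (c : ℝ)
    (p : E × ℝ) (v : E) (t : ℝ) :
    fderiv ℝ (fun p : E × ℝ => ψ (c • p.1) * χ p.2) p (v, t) =
      c * fderiv ℝ ψ (c • p.1) v * χ p.2 + ψ (c • p.1) * (t * deriv χ p.2) := by
  have h1 : HasFDerivAt (fun p : E × ℝ => ψ (c • p.1)) _ p :=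
    (hψ (c • p.1)).hasFDerivAt.comp p (hasFDerivAt_fst.const_smul c)
  have h2 : HasFDerivAt (fun p : E × ℝ => χ p.2) _ p :=
    (hχ p.2).hasDerivAt.hasFDerivAt.comp p hasFDerivAt_snd
  rw [(h1.fun_mul h2).fderiv]
  simp
  ring

theorem stmt_17 (N : ℕ) (M : ℝ) (hM : 0 ≤ M)
    (A : EuclideanSpace ℝ (Fin N) → ℝ → EuclideanSpace ℝ (Fin N))
    (hA : ContDiff ℝ 2 (fun p : EuclideanSpace ℝ (Fin N) × ℝ => A p.1 p.2))
    (hAper : ∀ (x : EuclideanSpace ℝ (Fin N)) (ξ : ℝ) (i : Fin N),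
      A (x + EuclideanSpace.single i 1) ξ = A x ξ)
    (hAdivfree : ∀ (ξ : ℝ) (x : EuclideanSpace ℝ (Fin N)),
      (∑ i : Fin N, fderiv ℝ (fun y => A y ξ) x (EuclideanSpace.single i 1) i) = 0)
    (u : EuclideanSpace ℝ (Fin N) → ℝ) (hu : Measurable u)
    (huper : ∀ (x : EuclideanSpace ℝ (Fin N)) (i : Fin N),
      u (x + EuclideanSpace.single i 1) = u x)
    (hubd : ∀ x, |u x| ≤ M)
    (m : Measure (EuclideanSpace ℝ (Fin N) × ℝ)) [IsLocallyFiniteMeasure m]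
    (hmper : ∀ i : Fin N,
      m.map (fun p => (p.1 + EuclideanSpace.single i 1, p.2)) = m)
    (hmsupp : m {p : EuclideanSpace ℝ (Fin N) × ℝ | M < |p.2|} = 0)
    (hkin : ∀ φ : (EuclideanSpace ℝ (Fin N) × ℝ) → ℝ,
      ContDiff ℝ (⊤ : ℕ∞) φ → HasCompactSupport φ →
      (∫ p : EuclideanSpace ℝ (Fin N) × ℝ,
          (if p.2 < u p.1 then (1:ℝ) else 0) *
            fderiv ℝ φ p (deriv (fun s => A p.1 s) p.2, 0))
        = ∫ p, fderiv ℝ φ p (0, 1) ∂m) :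
    m = 0 := by
  obtain ⟨χ, hχ, hχ0, hχ1⟩ := exists_contDiff_deriv_eq_one hM
  let ψ : ContDiffBump (0 : EuclideanSpace ℝ (Fin N)) :=
    ⟨N + 1, N + 2, by positivity, by linarith⟩
  have hψ : ContDiff ℝ (⊤ : ℕ∞) ψ := ψ.contDiff
  have hψd : Differentiable ℝ ψ := hψ.differentiable (by simp)
  have hχd : Differentiable ℝ χ := hχ.differentiable (by simp)
  have hχc : HasCompactSupport χ := HasCompactSupport.intro
    (isCompact_Icc (a := -(M + 2)) (b := M + 2)) fun s hs =>
      hχ0 s (not_le.1 fun h => hs (abs_le.1 h))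
  obtain ⟨Ca, hCa⟩ := exists_norm_deriv_le (hA.of_le one_le_two) hAper (M + 2)
  obtain ⟨Cχ, hCχ⟩ := hχ.continuous.bounded_above_of_compact_support hχc
  obtain ⟨Cψ, hCψ⟩ := (hψ.continuous_fderiv (by simp)).bounded_above_of_compact_support
    (ψ.hasCompactSupport.fderiv ℝ)
  have hCa0 : 0 ≤ Ca := (norm_nonneg _).trans (hCa 0 0 (by simp; linarith))
  have hCχ0 : 0 ≤ Cχ := (norm_nonneg _).trans (hCχ 0)
  have hCψ0 : 0 ≤ Cψ := (norm_nonneg _).trans (hCψ 0)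
  let I : Set ℝ := Set.Icc (-M) M
  let V : ℝ := (volume : Measure (EuclideanSpace ℝ (Fin N))).real (Metric.ball 0 (N + 2))
  let W : ℝ := (volume : Measure ℝ).real (Set.Icc (-(M + 2)) (M + 2))
  have key (n : ℕ) (hn : 0 < n) :
      m.real (unitCube N ×ˢ I) ≤ Cψ * Ca * Cχ * V * W / n := by
    have hn' : (0 : ℝ) < n := by exact_mod_cast hn
    let φ : EuclideanSpace ℝ (Fin N) × ℝ → ℝ := fun p => ψ ((n : ℝ)⁻¹ • p.1) * χ p.2
    let K : Set (EuclideanSpace ℝ (Fin N) × ℝ) :=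
      Metric.ball 0 (n * (N + 2)) ×ˢ Set.Icc (-(M + 2)) (M + 2)
    have hψ0 (x : EuclideanSpace ℝ (Fin N)) (hx : x ∉ Metric.ball 0 (n * ((N : ℝ) + 2))) :
        (n : ℝ)⁻¹ • x ∉ Metric.ball 0 ((N : ℝ) + 2) := by
      simp only [mem_ball_zero_iff, not_lt, norm_smul, norm_inv, RCLike.norm_natCast] at hx ⊢
      rwa [inv_mul_eq_div, le_div_iff₀ hn', mul_comm]
    have hφ : ContDiff ℝ (⊤ : ℕ∞) φ :=
      (hψ.comp (contDiff_fst.const_smul _)).mul (hχ.comp contDiff_snd)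
    have hφc : HasCompactSupport φ := by
      refine HasCompactSupport.intro
        ((isCompact_closedBall (0 : EuclideanSpace ℝ (Fin N)) (n * (N + 2))).prod
          (isCompact_Icc (a := -(M + 2)) (b := M + 2))) fun p hp => ?_
      by_cases h2 : p.2 ∈ Set.Icc (-(M + 2)) (M + 2)
      · have h1 := hψ0 p.1 fun h => hp ⟨Metric.ball_subset_closedBall h, h2⟩
        have : ψ ((n : ℝ)⁻¹ • p.1) = 0 := ψ.zero_of_le_dist (not_lt.1 h1)
        simp [φ, this]
      · simp [φ, hχ0 p.2 (not_le.1 fun h => h2 (abs_le.1 h))]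
    have hupper : ∫ p : EuclideanSpace ℝ (Fin N) × ℝ, (if p.2 < u p.1 then (1:ℝ) else 0) *
        fderiv ℝ φ p (deriv (fun s => A p.1 s) p.2, 0) ≤
          (n : ℝ)⁻¹ * (Cψ * Ca) * Cχ * (n ^ N * V * W) := by
      have hvol : (volume : Measure (EuclideanSpace ℝ (Fin N) × ℝ)).real K = n ^ N * V * W := by
        rw [Measure.volume_eq_prod, measureReal_prod_prod]
        congr 1
        rw [measureReal_def, Measure.addHaar_ball_mul_of_pos _ _ hn']
        simp [V, measureReal_def, ENNReal.toReal_mul, hn'.le]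
      have hK : volume K < ⊤ := by
        rw [Measure.volume_eq_prod, Measure.prod_prod]
        exact ENNReal.mul_lt_top measure_ball_lt_top measure_Icc_lt_top
      rw [← setIntegral_eq_integral_of_forall_compl_eq_zero (s := K), ← hvol]
      · refine (Real.le_norm_self _).trans (norm_setIntegral_le_of_norm_le_const hK fun p hp => ?_)
        have hf : ‖(if p.2 < u p.1 then (1:ℝ) else 0)‖ ≤ 1 := by split_ifs <;> simp
        rw [fderiv_dilate_mul_apply hψd hχd, zero_mul, mul_zero, add_zero, norm_mul, norm_mul,
          norm_mul, norm_inv, RCLike.norm_natCast]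
        calc _ ≤ 1 * ((n : ℝ)⁻¹ * (Cψ * Ca) * Cχ) := by
              gcongr
              · exact (ContinuousLinearMap.le_opNorm _ _).trans
                  (mul_le_mul (hCψ _) (hCa _ _ (abs_le.2 hp.2)) (norm_nonneg _) hCψ0)
              · exact hCχ _
          _ = _ := one_mul _
      · intro p hp
        rw [fderiv_dilate_mul_apply hψd hχd, zero_mul, mul_zero, add_zero]
        by_cases h2 : p.2 ∈ Set.Icc (-(M + 2)) (M + 2)
        · have h1 := hψ0 p.1 fun h => hp ⟨h, h2⟩
          have : fderiv ℝ ψ ((n : ℝ)⁻¹ • p.1) = 0 := by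
            have hmin : IsLocalMin ψ ((n : ℝ)⁻¹ • p.1) := by
              refine Filter.Eventually.of_forall fun y => ?_
              rw [ψ.zero_of_le_dist (not_lt.1 h1)]
              exact ψ.nonneg
            exact hmin.fderiv_eq_zero
          simp [this]
        · simp [hχ0 p.2 (not_le.1 fun h => h2 (abs_le.1 h))]
    have hlower : m.real ({x | ∀ i, x i ∈ Set.Icc (0 : ℝ) n} ×ˢ I) ≤
        ∫ p, fderiv ℝ φ p (0, 1) ∂m := by
      have hmeas : MeasurableSet ({x : EuclideanSpace ℝ (Fin N) | ∀ i, x i ∈ Set.Icc (0 : ℝ) n}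
          ×ˢ I) := by
        refine MeasurableSet.prod ?_ measurableSet_Icc
        rw [Set.ofPred_forall]
        exact MeasurableSet.iInter fun i => measurableSet_Icc.preimage (by fun_prop)
      have hint : Integrable (fun p => fderiv ℝ φ p (0, 1)) m :=
        ((hφ.continuous_fderiv (by simp)).clm_apply
          continuous_const).integrable_of_hasCompactSupport (hφc.fderiv_apply ℝ (0, 1))
      have hle : ({x : EuclideanSpace ℝ (Fin N) | ∀ i, x i ∈ Set.Icc (0 : ℝ) n} ×ˢ I).indicator
          (1 : EuclideanSpace ℝ (Fin N) × ℝ → ℝ) ≤ᵐ[m] fun p => fderiv ℝ φ p (0, 1) := by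
        have hae : ∀ᵐ p ∂m, |p.2| ≤ M := by
          rw [ae_iff]
          simpa using hmsupp
        filter_upwards [hae] with p hp
        rw [fderiv_dilate_mul_apply hψd hχd, hχ1 _ hp, map_zero, mul_zero, zero_mul, zero_add,
          mul_one, mul_one]
        refine Set.indicator_apply_le' (fun hpB => ?_) (fun _ => ψ.nonneg)
        refine (ψ.one_of_mem_closedBall ?_).ge
        have := norm_le_of_forall_mem_Icc hn'.le hpB.1
        simp only [mem_closedBall_zero_iff, norm_smul, norm_inv, RCLike.norm_natCast]
        rwa [inv_mul_eq_div, div_le_iff₀ hn']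
      rw [← integral_indicator_one hmeas]
      refine integral_mono_of_nonneg ?_ hint hle
      exact Filter.Eventually.of_forall fun p => Set.indicator_nonneg (by simp) p
    have hfin : m ({x | ∀ i, x i ∈ Set.Icc (0 : ℝ) n} ×ˢ I) ≠ ⊤ := by
      refine (((isCompact_closedBall (0 : EuclideanSpace ℝ (Fin N)) ((N + 1) * n)).prod
        (isCompact_Icc (a := -M) (b := M))).measure_lt_top.trans_le' (measure_mono ?_)).ne
      exact Set.prod_mono (fun x hx => by simpa using norm_le_of_forall_mem_Icc hn'.le hx) subset_rfl
    have hcells := ENNReal.toReal_mono hfin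
      (pow_mul_measure_unitCube_le hmper (measurableSet_Icc (a := -M) (b := M)) n)
    rw [ENNReal.toReal_mul, ENNReal.toReal_pow, ENNReal.toReal_natCast] at hcells
    have hall : (n : ℝ) ^ N * m.real (unitCube N ×ˢ I) ≤
        n ^ N * (Cψ * Ca * Cχ * V * W / n) :=
      calc _ ≤ _ := hcells
        _ ≤ _ := hlower
        _ = _ := (hkin φ hφ hφc).symm
        _ ≤ _ := hupper
        _ = _ := by ring
    exact le_of_mul_le_mul_left hall (by positivity)
  have hcell : m.real (unitCube N ×ˢ I) ≤ 0 :=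
    ge_of_tendsto (tendsto_const_div_atTop_nhds_zero_nat _)
      (Filter.eventually_atTop.2 ⟨1, fun n hn => key n hn⟩)
  have hfin : m (unitCube N ×ˢ I) ≠ ⊤ := by
    refine (((isCompact_closedBall (0 : EuclideanSpace ℝ (Fin N)) (N + 1)).prod
      (isCompact_Icc (a := -M) (b := M))).measure_lt_top.trans_le' (measure_mono ?_)).ne
    refine Set.prod_mono (fun x hx => ?_) subset_rfl
    simpa using norm_le_of_forall_mem_Icc zero_le_one fun i => Set.Ico_subset_Icc_self (hx i)
  refine measure_eq_zero_of_measure_unitCube hmper measurableSet_Icc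
    ((measureReal_eq_zero_iff hfin).1 (hcell.antisymm measureReal_nonneg)) ?_
  refine measure_mono_null (fun p hp => ?_) hmsupp
  exact not_le.1 fun h => hp (abs_le.1 h)
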